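/- Every valid 24-round trajectory of activity patterns whose initial pattern is not identically false has total active-function count at least 53. -/

import Mathlib

/-- The block shuffle of the 16-branch generalized Feistel network (Randen):
position `k` receives the branch previously at position `shuffle k`. -/
def shuffle : Fin 16 → Fin 16 :=
  ![7, 2, 13, 4, 11, 8, 3, 6, 15, 0, 9, 10, 1, 14, 5, 12]

/-- An activity pattern: `b k = true` means branch `k` carries a nonzero difference. -/
abbrev Pattern := Fin 16 → Bool

/-- The even branch `b (2 i)` feeding round function `i`. -/
def evenBr (b : Pattern) (i : Fin 8) : Bool := b ⟨2 * i.val, by have := i.isLt; omega⟩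

/-- The odd branch `b (2 i + 1)` receiving the output of round function `i`. -/
def oddBr (b : Pattern) (i : Fin 8) : Bool := b ⟨2 * i.val + 1, by have := i.isLt; omega⟩

/-- The intermediate pattern `c` with `c (2 i) = b (2 i)` and `c (2 i + 1) = t i`. -/
def combine (b : Pattern) (t : Fin 8 → Bool) : Pattern := fun k =>
  if k.val % 2 = 0 then b k else t ⟨k.val / 2, by have := k.isLt; omega⟩

/-- One round of truncated-differential propagation: `b` transforms into `b'` iff
there is `t : Fin 8 → Bool` with `t i = false` whenever both inputs of round
function `i` are inactive, `t i = true` whenever exactly one input is active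
(`t i` is unconstrained if both inputs are active, since differences may cancel),
and `b' k = c (shuffle k)` where `c (2 i) = b (2 i)`, `c (2 i + 1) = t i`. -/
def Step (b b' : Pattern) : Prop :=
  ∃ t : Fin 8 → Bool,
    (∀ i : Fin 8,
      ((evenBr b i = false ∧ oddBr b i = false) → t i = false) ∧
      (xor (evenBr b i) (oddBr b i) = true → t i = true)) ∧
    (∀ k : Fin 16, b' k = combine b t (shuffle k))

/-- Number of active functions of a pattern: the number of `i : Fin 8` with
`b (2 i) = true`. -/
def activeFuncs (b : Pattern) : ℕ :=
  (Finset.univ.filter fun i : Fin 8 => evenBr b i = true).card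

/-- A valid `r`-round trajectory: each `b (j + 1)` arises from `b j` by one round. -/
def ValidTraj (r : ℕ) (b : ℕ → Pattern) : Prop :=
  ∀ j < r, Step (b j) (b (j + 1))

/-- Total active-function count of an `r`-round trajectory. -/
def totalActive (r : ℕ) (b : ℕ → Pattern) : ℕ :=
  ∑ j ∈ Finset.range r, activeFuncs (b j)

/-- The number whose bit `i`, for `i < 2 ^ (p + 1 + n)`, is bit `p` of `i`. -/
def maskBlock (p : ℕ) : ℕ → ℕ
  | 0 => (2 ^ 2 ^ p - 1) <<< 2 ^ p
  | n + 1 => maskBlock p n ||| maskBlock p n <<< 2 ^ (p + 1 + n)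

/-- The set of all `i < 2 ^ 22` whose bit `p` is set. -/
def bitMask (p : ℕ) : ℕ := maskBlock p (21 - p)

/-- Sets of pairs (accumulated cost `w`, pattern) are stored as the set bits of a natural number,
a pattern occupying the low 16 bits of the index and `w` the higher ones. This is the image of `S`
under a round function with input branch `p` and output branch `q`, cut off at cost 53:
an active `p` raises the cost by one, activates an inactive `q`, and may deactivate an active `q`. -/
def pairImage (p q S : ℕ) : ℕ :=
  let A := S &&& bitMask p
  let B := A &&& bitMask q
  ((S ^^^ A) ||| (B ||| B >>> 2 ^ q ||| (A ^^^ B) <<< 2 ^ q) <<< 2 ^ 16) % 2 ^ (53 * 2 ^ 16)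

/-- The input branch of round function `i`. -/
def evenIdx (i : Fin 8) : Fin 16 := ⟨2 * i.val, by have := i.isLt; omega⟩

/-- The output branch of round function `i`. -/
def oddIdx (i : Fin 8) : Fin 16 := ⟨2 * i.val + 1, by have := i.isLt; omega⟩

/-- The pairs (cost below 53, pattern) reachable after a number of rounds from nonzero patterns of
cost 0. Patterns are kept unshuffled: branch `k` after `j` rounds is stored at `shuffle^[j] k`. -/
def reach : ℕ → ℕ
  | 0 => 2 ^ 2 ^ 16 - 2
  | j + 1 => (List.finRange 8).foldl
      (fun S i => pairImage (shuffle^[j] (evenIdx i)) (shuffle^[j] (oddIdx i)) S) (reach j)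

theorem maskBlock_lt (p n : ℕ) : maskBlock p n < 2 ^ 2 ^ (p + 1 + n) := by
  induction n with
  | zero =>
    rw [maskBlock, add_zero, pow_succ, mul_two, pow_add, Nat.shiftLeft_eq]
    exact Nat.mul_lt_mul_of_pos_right (Nat.sub_lt (Nat.two_pow_pos _) one_pos)
      (Nat.two_pow_pos _)
  | succ n ih =>
    rw [maskBlock, ← add_assoc, pow_succ 2 (p + 1 + n), mul_two]
    refine Nat.or_lt_two_pow (ih.trans_le (Nat.pow_le_pow_right two_pos (Nat.le_add_right _ _))) ?_
    rw [Nat.shiftLeft_eq, pow_add 2 (2 ^ _) (2 ^ _)]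
    exact Nat.mul_lt_mul_of_pos_right ih (Nat.two_pow_pos _)

theorem testBit_maskBlock (p n i : ℕ) (hi : i < 2 ^ (p + 1 + n)) :
    (maskBlock p n).testBit i = i.testBit p := by
  induction n generalizing i with
  | zero =>
    have h2 : 2 ^ (p + 1 + 0) = 2 ^ p + 2 ^ p := by rw [Nat.add_zero, pow_succ]; ring
    rw [maskBlock, Nat.testBit_shiftLeft, Nat.testBit_two_pow_sub_one]
    by_cases h : i < 2 ^ p
    · simp [Nat.testBit_lt_two_pow h, h]
    · obtain ⟨j, rfl⟩ := Nat.exists_eq_add_of_le (not_lt.mp h)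
      have hj : j < 2 ^ p := by omega
      simp [Nat.testBit_two_pow_add_eq, Nat.testBit_lt_two_pow hj, hj]
  | succ n ih =>
    have h2 : 2 ^ (p + 1 + (n + 1)) = 2 ^ (p + 1 + n) + 2 ^ (p + 1 + n) := by
      rw [← add_assoc, pow_succ]; ring
    rw [maskBlock, Nat.testBit_or, Nat.testBit_shiftLeft]
    by_cases h : i < 2 ^ (p + 1 + n)
    · simp [ih i h, h]
    · obtain ⟨j, rfl⟩ := Nat.exists_eq_add_of_le (not_lt.mp h)
      have hj : j < 2 ^ (p + 1 + n) := by omega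
      have hz : (maskBlock p n).testBit (2 ^ (p + 1 + n) + j) = false :=
        Nat.testBit_lt_two_pow ((maskBlock_lt p n).trans_le 
          (Nat.pow_le_pow_right two_pos (Nat.le_add_right _ _)))
      rw [Nat.testBit_two_pow_add_gt (by omega)]
      simp [hz, ih j hj]

theorem ofBits_update_true {n : ℕ} (f : Fin n → Bool) (q : Fin n) :
    Nat.ofBits (Function.update f q true) = Nat.ofBits (Function.update f q false) + 2 ^ q.val := by
  induction n with
  | zero => exact q.elim0
  | succ n ih =>
    rw [Nat.ofBits_succ, Nat.ofBits_succ]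
    cases q using Fin.cases with
    | zero =>
      have h (v : Bool) : Function.update f 0 v ∘ Fin.succ = f ∘ Fin.succ := by
        ext k; simp
      simp [h]
    | succ q =>
      have h (v : Bool) : Function.update f q.succ v ∘ Fin.succ =
          Function.update (f ∘ Fin.succ) q v :=
        Function.update_comp_eq_of_injective f (Fin.succ_injective n) q v
      have h0 (v : Bool) : Function.update f q.succ v 0 = f 0 :=
        Function.update_of_ne (Fin.succ_ne_zero q).symm v f
      rw [h, h, h0, h0, ih, Fin.val_succ, pow_succ]
      ring

/-- The index of the pattern `f` at accumulated cost `w`. -/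
def code (w : ℕ) (f : Pattern) : ℕ := 2 ^ 16 * w + Nat.ofBits f

theorem code_lt {w m : ℕ} (hw : w < m) (f : Pattern) : code w f < m * 2 ^ 16 := by
  have := Nat.ofBits_lt_two_pow f
  unfold code; omega

theorem testBit_bitMask_code {w : ℕ} (hw : w < 53) (f : Pattern) (p : Fin 16) :
    (bitMask p).testBit (code w f) = f p := by
  have hlt := code_lt hw f
  rw [bitMask, testBit_maskBlock _ _ _ (hlt.trans_le _), code,
    Nat.testBit_two_pow_mul_add _ (Nat.ofBits_lt_two_pow f), if_pos p.isLt,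
    Nat.testBit_ofBits_lt _ _ p.isLt]
  rw [show p.val + 1 + (21 - p.val) = 22 by omega]
  norm_num

theorem testBit_pairImage {S w : ℕ} {f : Pattern} {p q : Fin 16} {v : Bool}
    (hS : S.testBit (code w f) = true) (hw : w + (f p).toNat < 53)
    (hzero : f p = false ∧ f q = false → v = false) (hone : xor (f p) (f q) = true → v = true) :
    (pairImage p q S).testBit (code (w + (f p).toNat) (Function.update f q v)) = true := by
  have hp := testBit_bitMask_code (show w < 53 by omega) f p
  have hq := testBit_bitMask_code (show w < 53 by omega) f q
  have hlt := code_lt hw (Function.update f q v)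
  rw [pairImage, Nat.testBit_mod_two_pow]
  simp only [hlt, decide_true, Bool.true_and, Nat.testBit_or, Bool.or_eq_true]
  cases hfp : f p
  · have hv : v = f q := by cases hfq : f q <;> simp_all
    left
    simp [hv, hS, hp, hfp]
  · right
    have hcode (g : Pattern) : code (w + 1) g = 2 ^ 16 + code w g := by unfold code; ring
    rw [hfp] at hp
    rw [Bool.toNat_true, hcode, Nat.testBit_shiftLeft, Nat.add_sub_cancel_left]
    simp only [ge_iff_le, Nat.le_add_right, decide_true, Bool.true_and, Nat.testBit_or]
    have hstep : code w (Function.update f q true) =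
        2 ^ q.val + code w (Function.update f q false) := by
      unfold code; rw [ofBits_update_true]; ring
    have hid : Function.update f q (f q) = f := Function.update_eq_self q f
    cases hfq : f q <;> rw [hfq] at hq hid
    · have hv : v = true := hone (by simp [hfp, hfq])
      rw [hid] at hstep
      simp [hv, hstep, hS, hp, hq]
    · cases v
      · rw [hid] at hstep
        simp [← hstep, hS, hp, hq]
      · simp [hid, hS, hp, hq]

theorem exists_testBit_foldl_pairImage {π : Fin 16 → Fin 16} (hπ : Function.Injective π)
    (e o t : Fin 8 → Bool)
    (hzero : ∀ i, e i = false ∧ o i = false → t i = false)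
    (hone : ∀ i, xor (e i) (o i) = true → t i = true)
    (l : List (Fin 8)) (hl : l.Nodup) (S w : ℕ) (f : Pattern)
    (he : ∀ i ∈ l, f (π (evenIdx i)) = e i) (ho : ∀ i ∈ l, f (π (oddIdx i)) = o i)
    (hS : S.testBit (code w f) = true) (hw : w + (l.map fun i => (e i).toNat).sum < 53) :
    ∃ g : Pattern,
      (l.foldl (fun S i => pairImage (π (evenIdx i)) (π (oddIdx i)) S) S).testBit
        (code (w + (l.map fun i => (e i).toNat).sum) g) = true ∧
      (∀ i ∈ l, g (π (oddIdx i)) = t i) ∧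
      ∀ k, (∀ i ∈ l, k ≠ oddIdx i) → g (π k) = f (π k) := by
  induction l generalizing S w f with
  | nil => exact ⟨f, by simpa using hS, by simp, by simp⟩
  | cons i l ih =>
    obtain ⟨hi, hl⟩ := List.nodup_cons.mp hl
    simp only [List.map_cons, List.sum_cons, ← add_assoc, List.foldl_cons] at hw ⊢
    have hei := he i List.mem_cons_self
    have hoi := ho i List.mem_cons_self
    have hne {k : Fin 16} (hk : k ≠ oddIdx i) :
        Function.update f (π (oddIdx i)) (t i) (π k) = f (π k) :=
      Function.update_of_ne (hπ.ne hk) _ _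
    have hodd {j : Fin 8} (hj : j ∈ l) : oddIdx j ≠ oddIdx i := by
      rintro h
      have : j = i := by simp only [oddIdx, Fin.mk.injEq] at h; omega
      exact hi (this ▸ hj)
    have himg := testBit_pairImage (p := π (evenIdx i)) (q := π (oddIdx i)) (v := t i) hS
      (by rw [hei]; omega) (by rw [hei, hoi]; exact hzero i) (by rw [hei, hoi]; exact hone i)
    rw [hei] at himg
    obtain ⟨g, hg, hgodd, hgrest⟩ := ih hl _ _ _
      (fun j hj => by
        rw [hne (by simp only [evenIdx, oddIdx, ne_eq, Fin.mk.injEq]; omega)]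
        exact he j (List.mem_cons_of_mem i hj))
      (fun j hj => by rw [hne (hodd hj)]; exact ho j (List.mem_cons_of_mem i hj))
      himg hw
    refine ⟨g, hg, ?_, fun k hk => ?_⟩
    · intro j hj
      rcases List.mem_cons.mp hj with rfl | hj
      · rw [hgrest _ fun j' hj' => (hodd hj').symm, Function.update_self]
      · exact hgodd j hj
    · rw [hgrest k fun j hj => hk j (List.mem_cons_of_mem i hj), hne (hk i List.mem_cons_self)]

theorem activeFuncs_eq_sum (b : Pattern) :
    activeFuncs b = ((List.finRange 8).map fun i => (evenBr b i).toNat).sum := by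
  rw [activeFuncs, Finset.card_filter, ← Fin.sum_univ_def]
  refine Finset.sum_congr rfl fun i _ => ?_
  cases evenBr b i <;> rfl

theorem shuffle_injective : Function.Injective shuffle := by decide

theorem testBit_reach_zero {f : Pattern} (hf : ∃ k, f k = true) :
    (reach 0).testBit (code 0 f) = true := by
  obtain ⟨k, hk⟩ := hf
  have hpos : Nat.ofBits f ≠ 0 := fun h => by
    have := Nat.testBit_ofBits_lt f k k.isLt
    simp [h, hk] at this
  have hlt : Nat.ofBits f < 2 ^ 16 := Nat.ofBits_lt_two_pow f
  rw [code, mul_zero, zero_add, reach,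
    Nat.testBit_two_pow_sub_succ (x := 1) (Nat.one_lt_two_pow (by positivity))]
  have hone : Nat.testBit 1 (Nat.ofBits f) = false := by
    rw [Bool.eq_false_iff, ne_eq, Nat.testBit_one_eq_true_iff_self_eq_zero]
    exact hpos
  rw [decide_eq_true hlt, hone]
  rfl

theorem exists_testBit_reach {r : ℕ} {b : ℕ → Pattern} (hb : ValidTraj r b)
    (h0 : ∃ k, b 0 k = true) (hlt : totalActive r b < 53) :
    ∃ f : Pattern, (reach r).testBit (code (totalActive r b) f) = true ∧
      ∀ k, f (shuffle^[r] k) = b r k := by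
  induction r with
  | zero => exact ⟨b 0, testBit_reach_zero h0, fun _ => rfl⟩
  | succ r ih =>
    have hsum : totalActive (r + 1) b = totalActive r b + activeFuncs (b r) :=
      Finset.sum_range_succ _ _
    obtain ⟨f, hS, hf⟩ := ih (fun j hj => hb j (by omega)) (by omega)
    obtain ⟨t, ht, hnext⟩ := hb r (by omega)
    rw [hsum, activeFuncs_eq_sum] at hlt ⊢
    obtain ⟨g, hg, hodd, hrest⟩ := exists_testBit_foldl_pairImage
      (shuffle_injective.iterate r) (evenBr (b r)) (oddBr (b r)) t (fun i => (ht i).1)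
      (fun i => (ht i).2) (List.finRange 8) (List.nodup_finRange 8) (reach r) _ f
      (fun i _ => hf _) (fun i _ => hf _) hS hlt
    refine ⟨g, hg, fun k => ?_⟩
    rw [Function.iterate_succ_apply, hnext, combine]
    generalize shuffle k = m
    split_ifs with hm
    · rw [hrest m fun i _ h => by simp [h, oddIdx, Nat.add_mod] at hm, hf]
    · rw [← hodd _ (List.mem_finRange _)]
      congr 2
      ext
      simp only [oddIdx]
      omega

theorem reach_twentyfour : reach 24 = 0 := by decide +kernel

theorem twentyfour_rounds_at_least_53_active :
    ∀ b : ℕ → Pattern, ValidTraj 24 b → (∃ k, b 0 k = true) →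
      53 ≤ totalActive 24 b := by
  intro b hb h0
  by_contra! hlt
  obtain ⟨f, hf, -⟩ := exists_testBit_reach hb h0 hlt
  simp [reach_twentyfour] at hf
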